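/- Let d ≥ 2, r ∈ F_q^*, and m, m' ∈ F_q^d. Then Σ_{t ∈ F_q} Ŝ_t(m)·Ŝ_{rt}(m') equals q^{−1}·δ_0(m)·δ_0(m') + q^{−2d}·G^{2d}·η(−r)^d·(1 − q^{−1}) if ||m|| = r·||m'||, and equals −q^{−2d−1}·G^{2d}·η(−r)^d if ||m|| ≠ r·||m'||. Here δ_0(m) = 1 if m is the zero vector and 0 otherwise. -/

import Mathlib

open Finset

def nrm {F : Type} [Field F] {d : ℕ} (x : Fin d → F) : F := ∑ i, x i ^ 2

noncomputable def ft {F : Type} [Field F] [Fintype F] (d : ℕ) (χ : AddChar F ℂ)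
    (f : (Fin d → F) → ℂ) (m : Fin d → F) : ℂ :=
  (Fintype.card F : ℂ) ^ (-(d : ℤ)) * ∑ x : Fin d → F, χ (-(∑ i, x i * m i)) * f x

noncomputable def sphereFT {F : Type} [Field F] [Fintype F] [DecidableEq F] (d : ℕ)
    (χ : AddChar F ℂ) (t : F) (m : Fin d → F) : ℂ :=
  ft d χ (fun x => if nrm x = t then 1 else 0) m

noncomputable def eta (F : Type) [Field F] [Fintype F] [DecidableEq F] (s : F) : ℂ :=
  ((quadraticChar F s : ℤ) : ℂ)

noncomputable def gSum (F : Type) [Field F] [Fintype F] [DecidableEq F] (χ : AddChar F ℂ) : ℂ :=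
  ∑ s ∈ Finset.univ.filter (fun s : F => s ≠ 0), eta F s * χ s

def nu {F : Type} [Field F] [Fintype F] [DecidableEq F] {d : ℕ}
    (E : Finset (Fin d → F)) (t : F) : ℕ :=
  ((E ×ˢ E).filter (fun p => nrm (p.1 - p.2) = t)).card

def distSet {F : Type} [Field F] {d : ℕ} (E : Finset (Fin d → F)) : Set F :=
  {t | ∃ x ∈ E, ∃ y ∈ E, nrm (x - y) = t}

def quotSet {F : Type} [Field F] {d : ℕ} (E : Finset (Fin d → F)) : Set F :=
  {r | ∃ a ∈ distSet E, ∃ b ∈ distSet E, b ≠ 0 ∧ r = a / b}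

def sphereCard (F : Type) [Field F] [Fintype F] [DecidableEq F] (d : ℕ) (t : F) : ℕ :=
  (Finset.univ.filter (fun x : Fin d → F => nrm x = t)).card

theorem AddChar.map_sum_eq_prod {A M ι : Type*} [AddCommMonoid A] [CommMonoid M] (ψ : AddChar A M)
    (s : Finset ι) (f : ι → A) : ψ (∑ i ∈ s, f i) = ∏ i ∈ s, ψ (f i) := by
  induction s using Finset.cons_induction with
  | empty => simp
  | cons a s ha ih => simp [AddChar.map_add_eq_mul, ih]

section QuadraticExpSum

variable {F : Type} [Field F] [Fintype F]

theorem ringChar_ne_two_of_odd_card (hq : Odd (Fintype.card F)) : ringChar F ≠ 2 := by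
  intro h
  have h2 := FiniteField.even_card_of_char_two h
  have h3 := Nat.odd_iff.mp hq
  omega

/-- The `d`-dimensional exponential sum with phase `s * ‖x‖ - x ⬝ m`. -/
noncomputable def quadraticExpSum {d : ℕ} (χ : AddChar F ℂ) (s : F) (m : Fin d → F) : ℂ :=
  ∑ x : Fin d → F, χ (s * nrm x - ∑ i, x i * m i)

theorem quadraticExpSum_eq_prod {d : ℕ} (χ : AddChar F ℂ) (s : F) (m : Fin d → F) :
    quadraticExpSum χ s m = ∏ i, ∑ x : F, χ (s * x ^ 2 - x * m i) := by
  rw [Finset.prod_univ_sum, Fintype.piFinset_univ, quadraticExpSum]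
  refine Finset.sum_congr rfl fun x _ => ?_
  rw [nrm, Finset.mul_sum, ← Finset.sum_sub_distrib, AddChar.map_sum_eq_prod]

variable [DecidableEq F]

theorem sum_addChar_mul (χ : AddChar F ℂ) (hχ : χ ≠ 1) (a : F) :
    ∑ t : F, χ (t * a) = if a = 0 then (Fintype.card F : ℂ) else 0 := by
  have := AddChar.sum_mulShift a (AddChar.IsPrimitive.of_ne_one hχ)
  push_cast at this
  exact this

theorem sum_comp_sq (h2 : ringChar F ≠ 2) (f : F → ℂ) :
    ∑ x : F, f (x ^ 2) = ∑ y : F, (1 + eta F y) * f y := by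
  rw [← Finset.sum_fiberwise (s := univ) (g := fun x : F => x ^ 2)]
  refine Finset.sum_congr rfl fun y _ => ?_
  rw [Finset.sum_congr rfl (g := fun _ => f y)
    (fun x hx => by rw [(Finset.mem_filter.mp hx).2]), Finset.sum_const, nsmul_eq_mul]
  congr 1
  have h := quadraticChar_card_sqrts h2 y
  have h' : (univ.filter fun x : F => x ^ 2 = y) = {x : F | x ^ 2 = y}.toFinset := by
    ext x; simp
  rw [h', eta, add_comm]
  exact_mod_cast h

theorem gSum_eq_sum (χ : AddChar F ℂ) : gSum F χ = ∑ s : F, eta F s * χ s := by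
  rw [gSum, Finset.sum_filter]
  refine Finset.sum_congr rfl fun s _ => ?_
  by_cases hs : s = 0 <;> simp [hs, eta]

theorem eta_mul (a b : F) : eta F (a * b) = eta F a * eta F b := by
  rw [eta, map_mul, Int.cast_mul, eta, eta]

theorem eta_mul_self {a : F} (ha : a ≠ 0) : eta F a * eta F a = 1 := by
  have := quadraticChar_sq_one ha
  rw [eta, ← sq]
  exact_mod_cast this

theorem sum_eta_mul_addChar (χ : AddChar F ℂ) {s : F} (hs : s ≠ 0) :
    ∑ y : F, eta F y * χ (s * y) = eta F s * gSum F χ := by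
  rw [gSum_eq_sum, Finset.mul_sum, ← Equiv.sum_comp (Equiv.mulLeft₀ s hs)
    (fun y => eta F s * (eta F y * χ y))]
  refine Finset.sum_congr rfl fun y _ => ?_
  simp only [Equiv.mulLeft₀_apply, eta_mul]
  linear_combination (-(eta F y * χ (s * y))) * eta_mul_self hs

theorem sum_addChar_quadratic (h2 : ringChar F ≠ 2) (χ : AddChar F ℂ) (hχ : χ ≠ 1)
    {s : F} (hs : s ≠ 0) (a : F) :
    ∑ x : F, χ (s * x ^ 2 - x * a) = eta F s * gSum F χ * χ (-(a ^ 2 / (4 * s))) := by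
  have two : (2 : F) ≠ 0 := Ring.two_ne_zero h2
  have four : (4 : F) ≠ 0 := by
    rw [show (4 : F) = 2 * 2 by norm_num]; exact mul_ne_zero two two
  rw [← Equiv.sum_comp (Equiv.addRight (a / (2 * s)))]
  have key (x : F) : χ (s * (x + a / (2 * s)) ^ 2 - (x + a / (2 * s)) * a)
      = χ (s * x ^ 2) * χ (-(a ^ 2 / (4 * s))) := by
    rw [← AddChar.map_add_eq_mul]
    congr 1
    rw [show (4 : F) = 2 * 2 by norm_num]
    field_simp
    ring
  simp only [Equiv.coe_addRight, key]
  rw [← Finset.sum_mul, sum_comp_sq h2 (fun y => χ (s * y))]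
  simp only [add_mul, one_mul, Finset.sum_add_distrib, sum_eta_mul_addChar χ hs]
  have h0 := sum_addChar_mul χ hχ s
  simp only [mul_comm _ s, if_neg hs] at h0
  rw [h0, zero_mul, zero_add]

theorem quadraticExpSum_zero {d : ℕ} (χ : AddChar F ℂ) (hχ : χ ≠ 1) (m : Fin d → F) :
    quadraticExpSum χ 0 m = if m = 0 then (Fintype.card F : ℂ) ^ d else 0 := by
  rw [quadraticExpSum_eq_prod]
  have h (i : Fin d) : ∑ x : F, χ (0 * x ^ 2 - x * m i)
      = if m i = 0 then (Fintype.card F : ℂ) else 0 := by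
    simpa using sum_addChar_mul χ hχ (-(m i))
  simp only [h]
  split_ifs with hm
  · simp [hm]
  · obtain ⟨i, hi⟩ := Function.ne_iff.mp hm
    exact Finset.prod_eq_zero (Finset.mem_univ i) (if_neg hi)

theorem quadraticExpSum_of_ne_zero {d : ℕ} (h2 : ringChar F ≠ 2) (χ : AddChar F ℂ) (hχ : χ ≠ 1)
    {s : F} (hs : s ≠ 0) (m : Fin d → F) :
    quadraticExpSum χ s m = (eta F s * gSum F χ) ^ d * χ (-(nrm m / (4 * s))) := by
  rw [quadraticExpSum_eq_prod]
  simp only [sum_addChar_quadratic h2 χ hχ hs]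
  rw [Finset.prod_mul_distrib, ← AddChar.map_sum_eq_prod]
  simp [nrm, Finset.sum_div, Finset.sum_neg_distrib]

theorem sphereFT_eq_sum {d : ℕ} (χ : AddChar F ℂ) (hχ : χ ≠ 1) (t : F) (m : Fin d → F) :
    sphereFT d χ t m = (Fintype.card F : ℂ) ^ (-(d : ℤ)) * (Fintype.card F : ℂ)⁻¹ *
      ∑ s : F, χ (-(s * t)) * quadraticExpSum χ s m := by
  have hc : (Fintype.card F : ℂ) ≠ 0 := Nat.cast_ne_zero.mpr Fintype.card_ne_zero
  rw [sphereFT, ft, mul_assoc]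
  congr 1
  simp only [quadraticExpSum, Finset.mul_sum]
  rw [Finset.sum_comm]
  refine Finset.sum_congr rfl fun x _ => ?_
  have h (s : F) : χ (-(s * t)) * χ (s * nrm x - ∑ i, x i * m i)
      = χ (-(∑ i, x i * m i)) * χ (s * (nrm x - t)) := by
    rw [← AddChar.map_add_eq_mul, ← AddChar.map_add_eq_mul]
    congr 1
    ring
  simp only [h]
  rw [← Finset.mul_sum, ← Finset.mul_sum, sum_addChar_mul χ hχ]
  simp only [sub_eq_zero]
  split_ifs
  · field_simp
  · simp

theorem sum_sphereFT_mul_sphereFT {d : ℕ} (χ : AddChar F ℂ) (hχ : χ ≠ 1) (r : F)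
    (m m' : Fin d → F) :
    ∑ t : F, sphereFT d χ t m * sphereFT d χ (r * t) m'
      = ((Fintype.card F : ℂ) ^ (-(d : ℤ))) ^ 2 * (Fintype.card F : ℂ)⁻¹ *
        ∑ s : F, quadraticExpSum χ (-(r * s)) m * quadraticExpSum χ s m' := by
  have hc : (Fintype.card F : ℂ) ≠ 0 := Nat.cast_ne_zero.mpr Fintype.card_ne_zero
  have orth : ∑ t : F, (∑ u : F, χ (-(u * t)) * quadraticExpSum χ u m) *
        ∑ s : F, χ (-(s * (r * t))) * quadraticExpSum χ s m'
      = (Fintype.card F : ℂ) *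
        ∑ s : F, quadraticExpSum χ (-(r * s)) m * quadraticExpSum χ s m' := by
    simp only [Finset.sum_mul_sum]
    rw [Finset.sum_congr rfl fun t _ => Finset.sum_comm, Finset.sum_comm, Finset.mul_sum]
    refine Finset.sum_congr rfl fun s _ => ?_
    rw [Finset.sum_comm]
    have h (u t : F) : χ (-(u * t)) * quadraticExpSum χ u m *
          (χ (-(s * (r * t))) * quadraticExpSum χ s m')
        = χ (t * (-(r * s) - u)) * (quadraticExpSum χ u m * quadraticExpSum χ s m') := by
      rw [show t * (-(r * s) - u) = -(u * t) + -(s * (r * t)) by ring,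
        AddChar.map_add_eq_mul]
      ring
    simp only [h, ← Finset.sum_mul, sum_addChar_mul χ hχ, sub_eq_zero, ite_mul, zero_mul,
      Finset.sum_ite_eq, Finset.mem_univ, if_true]
  simp only [sphereFT_eq_sum χ hχ]
  rw [Finset.sum_congr rfl fun t _ => mul_mul_mul_comm _ _ _ _, ← Finset.mul_sum, orth]
  field_simp

theorem sum_erase_addChar_div (χ : AddChar F ℂ) (hχ : χ ≠ 1) (a : F) :
    ∑ s ∈ univ.erase (0 : F), χ (a / s) = if a = 0 then (Fintype.card F : ℂ) - 1 else -1 := by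
  have h : ∑ s : F, χ (a / s) = if a = 0 then (Fintype.card F : ℂ) else 0 := by
    rw [← sum_addChar_mul χ hχ a, ← Equiv.sum_comp (Equiv.inv F)]
    refine Finset.sum_congr rfl fun s _ => ?_
    simp [mul_comm]
  rw [Finset.sum_erase_eq_sub (Finset.mem_univ _), h]
  split_ifs <;> simp

theorem sum_quadraticExpSum_mul {d : ℕ} (h2 : ringChar F ≠ 2) (χ : AddChar F ℂ) (hχ : χ ≠ 1)
    {r : F} (hr : r ≠ 0) (m m' : Fin d → F) :
    ∑ s : F, quadraticExpSum χ (-(r * s)) m * quadraticExpSum χ s m'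
      = (if m = 0 then (Fintype.card F : ℂ) ^ d else 0) *
          (if m' = 0 then (Fintype.card F : ℂ) ^ d else 0)
        + eta F (-r) ^ d * gSum F χ ^ (2 * d) *
          (if nrm m = r * nrm m' then (Fintype.card F : ℂ) - 1 else -1) := by
  have two : (2 : F) ≠ 0 := Ring.two_ne_zero h2
  have four : (4 : F) ≠ 0 := by
    rw [show (4 : F) = 2 * 2 by norm_num]; exact mul_ne_zero two two
  rw [← Finset.add_sum_erase _ _ (Finset.mem_univ (0 : F)), mul_zero, neg_zero,
    quadraticExpSum_zero χ hχ, quadraticExpSum_zero χ hχ]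
  congr 1
  have h (s : F) (hs : s ∈ univ.erase (0 : F)) :
      quadraticExpSum χ (-(r * s)) m * quadraticExpSum χ s m'
        = eta F (-r) ^ d * gSum F χ ^ (2 * d) * χ ((nrm m - r * nrm m') / (4 * r) / s) := by
    have hs := Finset.ne_of_mem_erase hs
    rw [quadraticExpSum_of_ne_zero h2 χ hχ (neg_ne_zero.mpr (mul_ne_zero hr hs)),
      quadraticExpSum_of_ne_zero h2 χ hχ hs, mul_mul_mul_comm, ← AddChar.map_add_eq_mul,
      ← mul_pow]
    congr 1
    · rw [← neg_mul, eta_mul, pow_mul, ← mul_pow]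
      congr 1
      linear_combination eta F (-r) * gSum F χ ^ 2 * eta_mul_self hs
    · congr 1
      field_simp
      ring
  rw [Finset.sum_congr rfl h, ← Finset.mul_sum, sum_erase_addChar_div χ hχ]
  simp [hr, four, sub_eq_zero]

end QuadraticExpSum

theorem orth_sum_general (F : Type) [Field F] [Fintype F] [DecidableEq F]
    (hq : Odd (Fintype.card F)) (d : ℕ) (hd : 2 ≤ d)
    (χ : AddChar F ℂ) (hχ : χ ≠ 1) (r : F) (hr : r ≠ 0) (m m' : Fin d → F) :
    ∑ t : F, sphereFT d χ t m * sphereFT d χ (r * t) m'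
      = if nrm m = r * nrm m' then
          (Fintype.card F : ℂ)⁻¹ * (if m = 0 then 1 else 0) * (if m' = 0 then 1 else 0)
            + (Fintype.card F : ℂ) ^ (-(2 * d : ℤ)) * (gSum F χ) ^ (2 * d)
              * (eta F (-r)) ^ d * (1 - (Fintype.card F : ℂ)⁻¹)
        else
          -(Fintype.card F : ℂ) ^ (-(2 * d : ℤ) - 1) * (gSum F χ) ^ (2 * d)
            * (eta F (-r)) ^ d := by
  have hc : (Fintype.card F : ℂ) ≠ 0 := Nat.cast_ne_zero.mpr Fintype.card_ne_zero
  have hz : (Fintype.card F : ℂ) ^ (-(2 * d : ℤ)) = ((Fintype.card F : ℂ) ^ (-(d : ℤ))) ^ 2 := by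
    rw [← zpow_natCast, ← zpow_mul]
    congr 1
    push_cast
    ring
  have hd' : (Fintype.card F : ℂ) ^ (-(d : ℤ)) * (Fintype.card F : ℂ) ^ d = 1 := by
    rw [zpow_neg, zpow_natCast, inv_mul_cancel₀ (pow_ne_zero _ hc)]
  rw [sum_sphereFT_mul_sphereFT χ hχ,
    sum_quadraticExpSum_mul (ringChar_ne_two_of_odd_card hq) χ hχ hr, zpow_sub_one₀ hc, hz]
  generalize (Fintype.card F : ℂ) ^ (-(d : ℤ)) = p at hd' ⊢
  have hm (x : Fin d → F) : (if x = 0 then (Fintype.card F : ℂ) ^ d else 0)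
      = (Fintype.card F : ℂ) ^ d * (if x = 0 then 1 else 0) := by simp
  rw [hm m, hm m']
  by_cases h : nrm m = r * nrm m'
  · rw [if_pos h, if_pos h]
    generalize (if m = 0 then (1 : ℂ) else 0) = A
    generalize (if m' = 0 then (1 : ℂ) else 0) = B
    linear_combination (Fintype.card F : ℂ)⁻¹ * A * B * (p * (Fintype.card F : ℂ) ^ d + 1) * hd'
      + p ^ 2 * eta F (-r) ^ d * gSum F χ ^ (2 * d) * inv_mul_cancel₀ hc
  · have hAB : (if m = 0 then (1 : ℂ) else 0) * (if m' = 0 then 1 else 0) = 0 := by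
      split_ifs with h₁ h₂
      · exact absurd (by simp [h₁, h₂, nrm]) h
      all_goals simp
    rw [if_neg h, if_neg h]
    linear_combination p ^ 2 * (Fintype.card F : ℂ)⁻¹ * ((Fintype.card F : ℂ) ^ d) ^ 2 * hAB
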